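/- Let L ⊂ ℝ^r be a lattice of full rank r, let K ⊂ ℝ^r be a compact convex set with non-empty interior K°, let φ : K → ℝ be continuous with a unique maximum at an interior point x₀ ∈ K°, suppose φ is twice continuously differentiable in a neighbourhood of x₀ and the Hessian H = D²φ(x₀) is strictly negative definite, and let ψ : K₁ → ℝ be continuous on a neighbourhood K₁ ⊆ K of x₀ with ψ(x₀) > 0. Suppose that for each positive integer n there are a vector ℓ_n ∈ ℝ^r, a positive real b_n, and a function a_n : (L + ℓ_n) ∩ nK → ℝ such that, uniformly as n → ∞: a_n(ℓ) = O(b_n e^{nφ(ℓ/n) + o(n)}) for ℓ ∈ (L + ℓ_n) ∩ nK, and a_n(ℓ) = b_n (ψ(ℓ/n) + o(1)) e^{nφ(ℓ/n)} for ℓ ∈ (L + ℓ_n) ∩ nK₁. Then, as n → ∞, Σ_{ℓ ∈ (L+ℓ_n) ∩ nK} a_n(ℓ) ∼ (2π)^{r/2} ψ(x₀) b_n n^{r/2} e^{nφ(x₀)} / (Vol(L) · det(−H)^{1/2}). -/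

import Mathlib

open MeasureTheory Filter Topology
open scoped Matrix

/-- Second-order Taylor expansion with Peano remainder. -/
theorem ContDiffAt.isLittleO_sub_fderiv_sub_snd_fderiv {E F : Type*} [NormedAddCommGroup E]
    [NormedSpace ℝ E] [NormedAddCommGroup F] [NormedSpace ℝ F] {f : E → F} {x₀ : E}
    (hf : ContDiffAt ℝ 2 f x₀) :
    (fun x => f x - f x₀ - fderiv ℝ f x₀ (x - x₀)
      - (1 / 2 : ℝ) • fderiv ℝ (fderiv ℝ f) x₀ (x - x₀) (x - x₀))
      =o[𝓝 x₀] fun x => ‖x - x₀‖ ^ 2 := by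
  set D := fderiv ℝ (fderiv ℝ f) x₀ with hD
  have hsymm : IsSymmSndFDerivAt ℝ f x₀ := hf.isSymmSndFDerivAt (by simp)
  have hdiff : ∀ᶠ x in 𝓝 x₀, DifferentiableAt ℝ f x :=
    (hf.eventually (by simp)).mono fun x hx => hx.differentiableAt (by simp)
  have hsnd : HasFDerivAt (fderiv ℝ f) D x₀ :=
    ((hf.fderiv_right (m := 1) (by norm_num)).differentiableAt (by simp)).hasFDerivAt
  rw [Asymptotics.isLittleO_iff]
  intro c hc
  have hball := (hdiff.and (hsnd.isLittleO.def hc))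
  obtain ⟨ρ, hρ, hball⟩ := Metric.eventually_nhds_iff_ball.mp hball
  filter_upwards [Metric.ball_mem_nhds x₀ hρ] with x hx
  have hsub : ∀ y ∈ Metric.closedBall x₀ ‖x - x₀‖, y ∈ Metric.ball x₀ ρ := fun y hy => by
    rw [Metric.mem_ball] at *
    rw [Metric.mem_closedBall] at hy
    exact hy.trans_lt (by rwa [← dist_eq_norm])
  have hderiv : ∀ y ∈ Metric.closedBall x₀ ‖x - x₀‖,
      HasFDerivWithinAt (fun y => f y - fderiv ℝ f x₀ (y - x₀) - (1 / 2 : ℝ) • D (y - x₀) (y - x₀))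
        (fderiv ℝ f y - fderiv ℝ f x₀ - D (y - x₀)) (Metric.closedBall x₀ ‖x - x₀‖) y := by
    intro y hy
    have h1 := (hball y (hsub y hy)).1.hasFDerivAt
    have h2 : HasFDerivAt (fun y => y - x₀) (ContinuousLinearMap.id ℝ E) y :=
      (hasFDerivAt_id y).sub_const x₀
    have h3 := (D.hasFDerivAt.comp y h2).clm_apply h2
    have h4 := (fderiv ℝ f x₀).hasFDerivAt.comp y h2
    refine (((h1.sub h4).sub (h3.const_smul (1 / 2 : ℝ))).congr_fderiv ?_).hasFDerivWithinAt
    ext v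
    have hs : D v (y - x₀) = D (y - x₀) v := hsymm.eq _ _
    change fderiv ℝ f y v - fderiv ℝ f x₀ v - (1 / 2 : ℝ) • (D (y - x₀) v + D v (y - x₀)) =
      fderiv ℝ f y v - fderiv ℝ f x₀ v - D (y - x₀) v
    rw [hs, ← two_smul ℝ, smul_smul]
    norm_num
  have := (convex_closedBall x₀ ‖x - x₀‖).norm_image_sub_le_of_norm_hasFDerivWithin_le hderiv
    (C := c * ‖x - x₀‖)
    (fun y hy => (hball y (hsub y hy)).2.trans <| by
      gcongr
      simpa [dist_eq_norm] using hy)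
    (x := x₀) (y := x) (by simp) (by simp [dist_eq_norm])
  simp only [sub_self, map_zero, smul_zero, sub_zero] at this
  rw [show ‖‖x - x₀‖ ^ 2‖ = ‖x - x₀‖ * ‖x - x₀‖ by simp [sq], ← mul_assoc]
  convert this using 2
  abel

theorem measurable_floor_pi (ι : Type*) :
    Measurable fun (t : ι → ℝ) i => ⌊t i⌋ :=
  measurable_pi_lambda _ fun i => Int.measurable_floor.comp (measurable_pi_apply i)

/-- Coordinatewise floor pushes Lebesgue measure forward to counting measure. -/
theorem map_floor_volume (ι : Type*) [Fintype ι] :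
    (volume : Measure (ι → ℝ)).map (fun t i => ⌊t i⌋) = Measure.count := by
  refine Measure.ext_of_singleton fun c => ?_
  rw [Measure.map_apply (measurable_floor_pi ι) (measurableSet_singleton c), Measure.count_singleton]
  have : (fun (t : ι → ℝ) i => ⌊t i⌋) ⁻¹' {c} =
      Set.univ.pi fun i => Set.Ico (c i : ℝ) (c i + 1) := by
    ext t
    simp [funext_iff, Int.floor_eq_iff]
  simp [this, Real.volume_pi_Ico]

/-- A finitely supported sum over `ℤ^ι` is an integral of a step function over `ℝ^ι`. -/
theorem integral_floor_smul_add {ι : Type*} [Fintype ι] {g : (ι → ℤ) → ℝ}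
    (hg : g.support.Finite) {R : ℝ} (hR : 0 < R) (τ : ι → ℝ) :
    ∫ s : ι → ℝ, g (fun i => ⌊(R • s + τ) i⌋) = (R ^ Fintype.card ι)⁻¹ * ∑ᶠ c, g c := by
  have hcount : ∫ t : ι → ℝ, g (fun i => ⌊t i⌋) = ∑ᶠ c, g c := by
    have hint : Integrable g Measure.count := by
      rw [integrable_count_iff]
      exact (summable_of_hasFiniteSupport hg).norm
    rw [← integral_map (μ := volume) (φ := fun (t : ι → ℝ) i => ⌊t i⌋) (f := g)
      (measurable_floor_pi ι).aemeasurable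
      (measurable_of_countable g).aestronglyMeasurable, map_floor_volume, integral_countable hint,
      ← tsum_eq_finsum (L := SummationFilter.unconditional _) hg]
    simp [Measure.real]
  have h := Measure.integral_comp_smul (volume : Measure (ι → ℝ))
    (fun t => g (fun i => ⌊(t + τ) i⌋)) R
  rw [h, integral_add_right_eq_self (fun t : ι → ℝ => g (fun i => ⌊t i⌋)), hcount,
    Module.finrank_fintype_fun_eq_card, abs_of_pos (by positivity), smul_eq_mul]

open scoped MatrixOrder in
theorem Matrix.PosDef.exists_det_ne_zero_eq_transpose_mul_self {ι : Type*} [Fintype ι] [DecidableEq ι]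
    {A : Matrix ι ι ℝ} (hA : A.PosDef) : ∃ M : Matrix ι ι ℝ, M.det ≠ 0 ∧ A = Mᵀ * M := by
  have h0 : 0 ≤ A := Matrix.nonneg_iff_posSemidef.mpr hA.posSemidef
  have h1 : CFC.sqrt A * CFC.sqrt A = A := CFC.sqrt_mul_sqrt_self A h0
  have h2 : (CFC.sqrt A).IsHermitian :=
    (Matrix.nonneg_iff_posSemidef.mp (CFC.sqrt_nonneg A)).1
  refine ⟨CFC.sqrt A, fun h => hA.det_pos.ne' ?_, ?_⟩
  · rw [← h1, Matrix.det_mul, h, zero_mul]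
  · rw [← Matrix.conjTranspose_eq_transpose_of_trivial, h2.eq, h1]

theorem integrable_exp_neg_mul_sum_sq (ι : Type*) [Fintype ι] {c : ℝ} (hc : 0 < c) :
    Integrable fun s : ι → ℝ => Real.exp (-c * ∑ i, s i ^ 2) := by
  simp_rw [Finset.mul_sum, Real.exp_sum]
  exact Integrable.fintype_prod fun _ => integrable_exp_neg_mul_sq hc

theorem integrable_exp_neg_mul_norm_sq (ι : Type*) [Fintype ι] {c : ℝ} (hc : 0 < c) :
    Integrable fun s : ι → ℝ => Real.exp (-c * ‖s‖ ^ 2) := by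
  refine (integrable_exp_neg_mul_sum_sq ι (c := c / (Fintype.card ι + 1)) (by positivity)).mono'
    (by fun_prop) (.of_forall fun s => ?_)
  have h : ∑ i, s i ^ 2 ≤ (Fintype.card ι + 1) * ‖s‖ ^ 2 := by
    calc ∑ i, s i ^ 2 ≤ ∑ _i : ι, ‖s‖ ^ 2 := Finset.sum_le_sum fun i _ => by
          rw [← sq_abs (s i), ← Real.norm_eq_abs]
          gcongr
          exact norm_le_pi_norm s i
      _ ≤ _ := by simp; nlinarith [sq_nonneg ‖s‖]
  rw [Real.norm_eq_abs, Real.abs_exp, Real.exp_le_exp, neg_mul, neg_mul, neg_le_neg_iff,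
    div_mul_eq_mul_div, div_le_iff₀ (by positivity)]
  nlinarith

/-- The Gaussian integral attached to an invertible matrix. -/
theorem integral_exp_neg_half_sum_sq_mulVec {ι : Type*} [Fintype ι] [DecidableEq ι]
    {M : Matrix ι ι ℝ} (hM : M.det ≠ 0) :
    ∫ s : ι → ℝ, Real.exp (-(1 / 2) * ∑ i, (M *ᵥ s) i ^ 2) =
      (2 * Real.pi) ^ ((Fintype.card ι : ℝ) / 2) / |M.det| := by
  have hstd : ∫ s : ι → ℝ, Real.exp (-(1 / 2) * ∑ i, s i ^ 2) =
      (2 * Real.pi) ^ ((Fintype.card ι : ℝ) / 2) := by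
    simp_rw [Finset.mul_sum, Real.exp_sum]
    rw [integral_fintype_prod_volume_eq_pow (fun x : ℝ => Real.exp (-(1 / 2) * x ^ 2)),
      integral_gaussian, Real.sqrt_eq_rpow, ← Real.rpow_mul_natCast (by positivity)]
    congr 1 <;> ring
  rw [← hstd]
  have hmap := Real.map_matrix_volume_pi_eq_smul_volume_pi hM
  have h := integral_map (μ := (volume : Measure (ι → ℝ))) (φ := Matrix.toLin' M)
    (f := fun s => Real.exp (-(1 / 2) * ∑ i, s i ^ 2))
    (LinearMap.continuous_of_finiteDimensional _).aemeasurable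
    (Continuous.aestronglyMeasurable (by fun_prop))
  rw [hmap, integral_smul_measure, ENNReal.toReal_ofReal (abs_nonneg _)] at h
  simp only [Matrix.toLin'_apply] at h
  rw [← h, abs_inv, smul_eq_mul, inv_mul_eq_div]

/-- A continuous function with a strict maximum at `x₀` that is nondegenerate to second order lies
below a downward paraboloid on the whole compact set. -/
theorem IsCompact.exists_forall_le_sub_mul_norm_sq {E : Type*} [NormedAddCommGroup E]
    {K : Set E} (hK : IsCompact K) {φ : E → ℝ} (hφ : ContinuousOn φ K) {x₀ : E}
    (hmax : ∀ x ∈ K, x ≠ x₀ → φ x < φ x₀) {Q : E → ℝ} {q : ℝ} (hq : 0 < q)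
    (hQ : ∀ v, q * ‖v‖ ^ 2 ≤ Q v)
    (hT : (fun x => φ x - φ x₀ + 1 / 2 * Q (x - x₀)) =o[𝓝 x₀] fun x => ‖x - x₀‖ ^ 2) :
    ∃ c > 0, ∀ x ∈ K, φ x ≤ φ x₀ - c * ‖x - x₀‖ ^ 2 := by
  obtain ⟨ρ, hρ, hball⟩ :=
    Metric.eventually_nhds_iff_ball.mp (hT.def (c := q / 4) (by positivity))
  have hfar : ∃ c > 0, ∀ x ∈ K \ Metric.ball x₀ ρ, φ x ≤ φ x₀ - c * ‖x - x₀‖ ^ 2 := by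
    have hK' : IsCompact (K \ Metric.ball x₀ ρ) := hK.diff Metric.isOpen_ball
    have hpos : ∀ x ∈ K \ Metric.ball x₀ ρ, 0 < ‖x - x₀‖ := fun x hx => by
      have := hx.2
      rw [Metric.mem_ball, dist_eq_norm, not_lt] at this
      exact hρ.trans_le this
    rcases (K \ Metric.ball x₀ ρ).eq_empty_or_nonempty with he | hne
    · exact ⟨1, one_pos, by simp [he]⟩
    have hcont : ContinuousOn (fun x => (φ x₀ - φ x) / ‖x - x₀‖ ^ 2) (K \ Metric.ball x₀ ρ) := by
      refine ContinuousOn.div ?_ (by fun_prop) fun x hx => (pow_pos (hpos x hx) 2).ne'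
      exact continuousOn_const.sub (hφ.mono Set.sdiff_subset)
    obtain ⟨y, hy, hmin⟩ := hK'.exists_isMinOn hne hcont
    have hyx : y ≠ x₀ := fun h => by simpa [h] using hpos y hy
    refine ⟨_, div_pos (sub_pos.mpr (hmax y hy.1 hyx)) (pow_pos (hpos y hy) 2), fun x hx => ?_⟩
    have h := (le_div_iff₀ (pow_pos (hpos x hx) 2)).mp (hmin hx)
    linarith
  obtain ⟨c, hc, hfar⟩ := hfar
  refine ⟨min c (q / 4), by positivity, fun x hx => ?_⟩
  have hn := sq_nonneg ‖x - x₀‖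
  by_cases hxb : x ∈ Metric.ball x₀ ρ
  · have h := (le_abs_self _).trans (hball x hxb)
    rw [Real.norm_eq_abs, abs_of_nonneg hn] at h
    nlinarith [hQ (x - x₀), mul_le_mul_of_nonneg_right (min_le_right c (q / 4)) hn]
  · nlinarith [hfar x ⟨hx, hxb⟩, mul_le_mul_of_nonneg_right (min_le_left c (q / 4)) hn]

/-- Under the scaling `x n - x₀ ∼ v / √n`, the rescaled increment of a function that is quadratic
to leading order at `x₀` converges. -/
theorem tendsto_natCast_mul_sub_of_isLittleO {E : Type*} [NormedAddCommGroup E]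
    [NormedSpace ℝ E] {φ Q : E → ℝ} {x₀ v : E} (hQc : Continuous Q)
    (hQs : ∀ (t : ℝ) w, Q (t • w) = t ^ 2 * Q w)
    (hT : (fun x => φ x - φ x₀ + 1 / 2 * Q (x - x₀)) =o[𝓝 x₀] fun x => ‖x - x₀‖ ^ 2)
    {x : ℕ → E} (hx : Tendsto x atTop (𝓝 x₀))
    (hv : Tendsto (fun n : ℕ => √(n : ℝ) • (x n - x₀)) atTop (𝓝 v)) :
    Tendsto (fun n : ℕ => (n : ℝ) * (φ (x n) - φ x₀)) atTop (𝓝 (-(1 / 2) * Q v)) := by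
  have hsq : ∀ n : ℕ, √(n : ℝ) ^ 2 = n := fun n => Real.sq_sqrt n.cast_nonneg
  have hrem : Tendsto (fun n : ℕ => (n : ℝ) * (φ (x n) - φ x₀ + 1 / 2 * Q (x n - x₀)))
      atTop (𝓝 0) := by
    have h1 := (Asymptotics.isBigO_refl (fun n : ℕ => (n : ℝ)) atTop).mul_isLittleO
      (hT.comp_tendsto hx)
    have h2 : (fun n : ℕ => (n : ℝ) * ((fun x => ‖x - x₀‖ ^ 2) ∘ x) n) =O[atTop]
        fun _ => (1 : ℝ) := by
      refine ((hv.norm.pow 2).congr fun n => ?_).isBigO_one ℝ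
      rw [norm_smul, mul_pow, Real.norm_eq_abs, sq_abs, hsq]
      rfl
    exact (Asymptotics.isLittleO_one_iff ℝ).mp (h1.trans_isBigO h2)
  have hmain : Tendsto (fun n : ℕ => (1 / 2 : ℝ) * Q (√(n : ℝ) • (x n - x₀))) atTop
      (𝓝 (1 / 2 * Q v)) := ((hQc.tendsto v).comp hv).const_mul _
  have h := hrem.sub hmain
  rw [show 0 - 1 / 2 * Q v = -(1 / 2) * Q v by ring] at h
  refine h.congr fun n => ?_
  rw [hQs, hsq]
  ring

/-- Locally sharp and globally subexponential control of the coefficients combine into a single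
Gaussian bound on all of `K`. -/
theorem exists_gaussian_bound {E : Type*} [NormedAddCommGroup E] [NormedSpace ℝ E]
    {K K₁ : Set E} {φ ψ : E → ℝ} {x₀ : E} {c : ℝ} (hc : 0 < c)
    (hφ : ∀ x ∈ K, φ x ≤ φ x₀ - c * ‖x - x₀‖ ^ 2) (hK₁nhds : K₁ ∈ 𝓝 x₀)
    (hψ : ContinuousAt ψ x₀) {Λ : ℕ → Set E} {β : ℕ → ℝ} (hβ : ∀ n, 0 < β n) {a : ℕ → E → ℝ}
    {C : ℝ} {ε δ : ℕ → ℝ} (hε : Tendsto ε atTop (𝓝 0)) (hδ : Tendsto δ atTop (𝓝 0))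
    (hbig : ∀ n : ℕ, 1 ≤ n → ∀ ℓ ∈ Λ n, (n : ℝ)⁻¹ • ℓ ∈ K →
      |a n ℓ| ≤ C * β n * Real.exp (n * φ ((n : ℝ)⁻¹ • ℓ) + n * ε n))
    (hloc : ∀ n : ℕ, 1 ≤ n → ∀ ℓ ∈ Λ n, (n : ℝ)⁻¹ • ℓ ∈ K₁ →
      |a n ℓ - β n * ψ ((n : ℝ)⁻¹ • ℓ) * Real.exp (n * φ ((n : ℝ)⁻¹ • ℓ))| ≤
        β n * δ n * Real.exp (n * φ ((n : ℝ)⁻¹ • ℓ))) :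
    ∃ A > 0, ∃ κ > 0, ∀ᶠ n : ℕ in atTop, ∀ ℓ ∈ Λ n, (n : ℝ)⁻¹ • ℓ ∈ K →
      |a n ℓ| ≤ A * (β n * Real.exp (n * φ x₀)) *
        Real.exp (-κ * (n * ‖(n : ℝ)⁻¹ • ℓ - x₀‖ ^ 2)) := by
  have hψb : ∀ᶠ x in 𝓝 x₀, |ψ x| < |ψ x₀| + 1 :=
    hψ.abs.eventually_lt_const (lt_add_one _)
  obtain ⟨ρ, hρ, hball⟩ := Metric.eventually_nhds_iff_ball.mp (hψb.and hK₁nhds)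
  refine ⟨|C| + |ψ x₀| + 2, by positivity, c / 2, by positivity, ?_⟩
  filter_upwards [eventually_ge_atTop 1,
    hε.eventually_lt_const (show (0 : ℝ) < c * ρ ^ 2 / 2 by positivity),
    hδ.eventually_lt_const one_pos] with n hn hεn hδn ℓ hℓ hℓK
  set x := (n : ℝ)⁻¹ • ℓ with hx
  have hn0 : (0 : ℝ) ≤ n := n.cast_nonneg
  have hβn := hβ n
  have hφx := mul_le_mul_of_nonneg_left (hφ x hℓK) hn0
  have hd := mul_nonneg hn0 (sq_nonneg ‖x - x₀‖)
  have hrhs : (|C| + |ψ x₀| + 2) * (β n * Real.exp (n * φ x₀)) *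
      Real.exp (-(c / 2) * (n * ‖x - x₀‖ ^ 2)) = (|C| + |ψ x₀| + 2) * (β n *
        Real.exp (n * φ x₀ - c / 2 * (n * ‖x - x₀‖ ^ 2))) := by
    rw [sub_eq_add_neg (_ * φ x₀), Real.exp_add, neg_mul]
    ring
  rw [hrhs]
  by_cases hxb : x ∈ Metric.ball x₀ ρ
  · have h1 := hloc n hn ℓ hℓ (hball x hxb).2
    have h2 := (hball x hxb).1
    have h3 : |a n ℓ| ≤ |β n * ψ x * Real.exp (n * φ x)| + β n * δ n * Real.exp (n * φ x) := by
      have := abs_sub_abs_le_abs_sub (a n ℓ) (β n * ψ x * Real.exp (n * φ x))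
      linarith
    rw [abs_mul, abs_mul, Real.abs_exp, abs_of_pos hβn] at h3
    calc |a n ℓ| ≤ (|ψ x| + δ n) * (β n * Real.exp (n * φ x)) := by linarith
      _ ≤ (|C| + |ψ x₀| + 2) * (β n * Real.exp (n * φ x)) := by
        gcongr ?_ * _
        linarith [abs_nonneg C]
      _ ≤ _ := by
        gcongr
        nlinarith
  · have hρx : ρ ≤ ‖x - x₀‖ := by simpa [dist_eq_norm] using hxb
    have hεx : n * ε n ≤ c / 2 * (n * ‖x - x₀‖ ^ 2) := by
      have : ε n ≤ c / 2 * ‖x - x₀‖ ^ 2 := by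
        nlinarith [mul_le_mul_of_nonneg_left (pow_le_pow_left₀ hρ.le hρx 2) hc.le]
      nlinarith
    calc |a n ℓ| ≤ C * β n * Real.exp (n * φ x + n * ε n) := hbig n hn ℓ hℓ hℓK
      _ = C * (β n * Real.exp (n * φ x + n * ε n)) := by ring
      _ ≤ (|C| + |ψ x₀| + 2) * (β n * Real.exp (n * φ x + n * ε n)) := by
        gcongr
        linarith [le_abs_self C, abs_nonneg (ψ x₀)]
      _ ≤ _ := by
        gcongr
        nlinarith

theorem tendsto_inv_sqrt_natCast : Tendsto (fun n : ℕ => (√(n : ℝ))⁻¹) atTop (𝓝 0) :=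
  tendsto_inv_atTop_zero.comp (Real.tendsto_sqrt_atTop.comp tendsto_natCast_atTop_atTop)

section LatticePoints

variable {ι : Type*} [Fintype ι]

theorem norm_smul_fract_le (t : ι → ℝ) (n : ℕ) :
    ‖(√(n : ℝ))⁻¹ • fun i => Int.fract (t i)‖ ≤ (√(n : ℝ))⁻¹ := by
  rw [norm_smul, Real.norm_of_nonneg (by positivity)]
  refine mul_le_of_le_one_right (by positivity) ((pi_norm_le_iff_of_nonneg zero_le_one).mpr ?_)
  intro i
  rw [Real.norm_of_nonneg (Int.fract_nonneg _)]
  exact (Int.fract_lt_one _).le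

variable [DecidableEq ι] {B : Matrix ι ι ℝ}

theorem Matrix.exists_norm_le_mul_norm_mulVec (hB : B.det ≠ 0) :
    ∃ k > 0, ∀ v : ι → ℝ, ‖v‖ ≤ k * ‖B *ᵥ v‖ := by
  have hk : LinearMap.ker (Matrix.toLin' B) = ⊥ :=
    LinearMap.ker_eq_bot.mpr (Matrix.mulVec_injective_of_isUnit
      ((Matrix.isUnit_iff_isUnit_det _).mpr hB.isUnit))
  obtain ⟨k, hk0, hk⟩ := LinearMap.exists_antilipschitzWith _ hk
  exact ⟨k, hk0, fun v => by simpa using hk.le_mul_norm_sub v 0⟩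

theorem finite_setOf_latticePoint_mem (hB : B.det ≠ 0) {S : Set (ι → ℝ)}
    (hS : Bornology.IsBounded S) (ℓ : ι → ℝ) :
    {c : ι → ℤ | ℓ + B *ᵥ (fun i => (c i : ℝ)) ∈ S}.Finite := by
  obtain ⟨k, hk0, hk⟩ := Matrix.exists_norm_le_mul_norm_mulVec hB
  obtain ⟨D, hD⟩ := hS.exists_norm_le
  set N : ℤ := ⌈k * (D + ‖ℓ‖)⌉
  refine (Set.finite_Icc (fun _ : ι => -N) (fun _ => N)).subset fun c hc => ?_
  have hc' : ‖B *ᵥ (fun i => (c i : ℝ))‖ ≤ D + ‖ℓ‖ := by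
    have := norm_sub_le (ℓ + B *ᵥ (fun i => (c i : ℝ))) ℓ
    rw [add_sub_cancel_left] at this
    linarith [hD _ hc]
  have hci : ∀ i, |c i| ≤ N := fun i => by
    have h1 := norm_le_pi_norm (fun i => (c i : ℝ)) i
    have h2 : |(c i : ℝ)| ≤ N := (h1.trans (hk _)).trans
      ((mul_le_mul_of_nonneg_left hc' (le_of_lt hk0)).trans (Int.le_ceil _))
    exact_mod_cast h2
  exact ⟨fun i => (abs_le.mp (hci i)).1, fun i => (abs_le.mp (hci i)).2⟩

/-- Displacement from `x₀` of the rescaled lattice point attached to the unit cell of `s`. -/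
theorem sqrt_smul_latticePoint_sub (hB : B.det ≠ 0) (x₀ ℓ s : ι → ℝ) {n : ℕ} (hn : 1 ≤ n) :
    √(n : ℝ) • ((n : ℝ)⁻¹ • (ℓ + B *ᵥ fun i =>
      ((⌊(√(n : ℝ) • s + B⁻¹ *ᵥ ((n : ℝ) • x₀ - ℓ)) i⌋ : ℤ) : ℝ)) - x₀) =
    B *ᵥ (s - (√(n : ℝ))⁻¹ • fun i =>
      Int.fract ((√(n : ℝ) • s + B⁻¹ *ᵥ ((n : ℝ) • x₀ - ℓ)) i)) := by
  set t := √(n : ℝ) • s + B⁻¹ *ᵥ ((n : ℝ) • x₀ - ℓ) with ht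
  have hn0 : (0 : ℝ) < n := by exact_mod_cast hn
  have hs0 : 0 < √(n : ℝ) := Real.sqrt_pos.mpr hn0
  have hfloor : (fun i => ((⌊t i⌋ : ℤ) : ℝ)) = t - fun i => Int.fract (t i) := by
    ext i
    simp [Int.self_sub_fract]
  have hinv : B *ᵥ (B⁻¹ *ᵥ ((n : ℝ) • x₀ - ℓ)) = (n : ℝ) • x₀ - ℓ := by
    rw [Matrix.mulVec_mulVec, Matrix.mul_nonsing_inv _ hB.isUnit, Matrix.one_mulVec]
  rw [hfloor]
  generalize (fun i => Int.fract (t i)) = f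
  rw [ht, Matrix.mulVec_sub, Matrix.mulVec_add, Matrix.mulVec_smul, hinv, Matrix.mulVec_sub,
    Matrix.mulVec_smul]
  generalize B *ᵥ s = u
  generalize B *ᵥ f = w
  have h1 : √(n : ℝ) * (n : ℝ)⁻¹ = (√(n : ℝ))⁻¹ := by
    nth_rewrite 2 [← Real.mul_self_sqrt hn0.le]
    field_simp
  ext i
  simp only [Pi.smul_apply, Pi.sub_apply, Pi.add_apply, smul_eq_mul]
  have h2 : √(n : ℝ) * √(n : ℝ) = n := Real.mul_self_sqrt hn0.le
  rw [mul_sub, ← mul_assoc, h1]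
  field_simp
  rw [sq, h2]
  ring

end LatticePoints

/-- Laplace asymptotics for a sum over a shifted lattice, in normalized form, for a lattice with
basis matrix `B` and a phase whose Hessian at the maximum is `-Mᵀ M`. -/
theorem tendsto_latticeSum {ι : Type*} [Fintype ι] [DecidableEq ι] {M B : Matrix ι ι ℝ}
    (hM : M.det ≠ 0) (hB : B.det ≠ 0) {K K₁ : Set (ι → ℝ)} (hK : IsCompact K)
    {φ ψ : (ι → ℝ) → ℝ} (hφ : ContinuousOn φ K) {x₀ : ι → ℝ}
    (hmax : ∀ x ∈ K, x ≠ x₀ → φ x < φ x₀)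
    (hT : (fun x => φ x - φ x₀ + 1 / 2 * ∑ i, (M *ᵥ (x - x₀)) i ^ 2)
      =o[𝓝 x₀] fun x => ‖x - x₀‖ ^ 2)
    (hK₁ : K₁ ⊆ K) (hK₁nhds : K₁ ∈ 𝓝 x₀) (hψ : ContinuousAt ψ x₀)
    {ℓ : ℕ → ι → ℝ} {β : ℕ → ℝ} (hβ : ∀ n, 0 < β n) {a : ℕ → (ι → ℝ) → ℝ}
    {C : ℝ} {ε δ : ℕ → ℝ} (hε : Tendsto ε atTop (𝓝 0)) (hδ : Tendsto δ atTop (𝓝 0))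
    {p : ℕ → (ι → ℤ) → ι → ℝ} (hp : ∀ n c, p n c = ℓ n + B *ᵥ fun i => (c i : ℝ))
    (hbig : ∀ n : ℕ, 1 ≤ n → ∀ c, (n : ℝ)⁻¹ • p n c ∈ K →
      |a n (p n c)| ≤ C * β n * Real.exp (n * φ ((n : ℝ)⁻¹ • p n c) + n * ε n))
    (hloc : ∀ n : ℕ, 1 ≤ n → ∀ c, (n : ℝ)⁻¹ • p n c ∈ K₁ →
      |a n (p n c) - β n * ψ ((n : ℝ)⁻¹ • p n c) * Real.exp (n * φ ((n : ℝ)⁻¹ • p n c))| ≤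
        β n * δ n * Real.exp (n * φ ((n : ℝ)⁻¹ • p n c))) :
    Tendsto (fun n : ℕ => (√(n : ℝ) ^ Fintype.card ι)⁻¹ *
        ∑ᶠ c, {c | (n : ℝ)⁻¹ • p n c ∈ K}.indicator
          (fun c => a n (p n c) / (β n * Real.exp (n * φ x₀))) c) atTop
      (𝓝 (ψ x₀ * ((2 * Real.pi) ^ ((Fintype.card ι : ℝ) / 2) / |(M * B).det|))) := by
  set Q : (ι → ℝ) → ℝ := fun v => ∑ i, (M *ᵥ v) i ^ 2 with hQdef
  have hQc : Continuous Q := by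
    have : Continuous fun v => M *ᵥ v := (Matrix.toLin' M).continuous_of_finiteDimensional
    fun_prop
  have hQs : ∀ (t : ℝ) v, Q (t • v) = t ^ 2 * Q v := fun t v => by
    simp [hQdef, Matrix.mulVec_smul, mul_pow, Finset.mul_sum]
  obtain ⟨m, hm0, hm⟩ := Matrix.exists_norm_le_mul_norm_mulVec hM
  have hQm : ∀ v, (m ^ 2)⁻¹ * ‖v‖ ^ 2 ≤ Q v := fun v => by
    have h1 : ‖M *ᵥ v‖ ^ 2 ≤ Q v := by
      refine Real.le_sqrt (norm_nonneg _) (by positivity) |>.mp ?_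
      refine (pi_norm_le_iff_of_nonneg (Real.sqrt_nonneg _)).mpr fun i => ?_
      exact Real.abs_le_sqrt
        (Finset.single_le_sum (f := fun i => (M *ᵥ v) i ^ 2) (fun _ _ => sq_nonneg _)
          (Finset.mem_univ i))
    rw [inv_mul_le_iff₀ (by positivity)]
    calc ‖v‖ ^ 2 ≤ (m * ‖M *ᵥ v‖) ^ 2 := by gcongr; exact hm v
      _ ≤ _ := by rw [mul_pow]; gcongr
  obtain ⟨c₀, hc₀, hφc⟩ :=
    hK.exists_forall_le_sub_mul_norm_sq hφ hmax (by positivity) hQm hT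
  obtain ⟨A, hA, κ, hκ, hbound⟩ := exists_gaussian_bound (Λ := fun n => Set.range (p n))
    hc₀ hφc hK₁nhds hψ hβ hε hδ
    (fun n hn _ hl => by obtain ⟨c, rfl⟩ := hl; exact hbig n hn c)
    (fun n hn _ hl => by obtain ⟨c, rfl⟩ := hl; exact hloc n hn c)
  obtain ⟨k, hk0, hk⟩ := Matrix.exists_norm_le_mul_norm_mulVec hB
  set g : ℕ → (ι → ℤ) → ℝ := fun n => {c | (n : ℝ)⁻¹ • p n c ∈ K}.indicator
    (fun c => a n (p n c) / (β n * Real.exp (n * φ x₀))) with hg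
  set t : ℕ → (ι → ℝ) → ι → ℝ :=
    fun n s => √(n : ℝ) • s + B⁻¹ *ᵥ ((n : ℝ) • x₀ - ℓ n) with ht
  set x : ℕ → (ι → ℝ) → ι → ℝ := fun n s => (n : ℝ)⁻¹ • p n (fun i => ⌊t n s i⌋) with hx
  have hdisp : ∀ n : ℕ, 1 ≤ n → ∀ s, √(n : ℝ) • (x n s - x₀) =
      B *ᵥ (s - (√(n : ℝ))⁻¹ • fun i => Int.fract (t n s i)) := fun n hn s => by
    simp only [hx, hp]
    exact sqrt_smul_latticePoint_sub hB x₀ (ℓ n) s hn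
  have hsum : (fun n : ℕ => ∫ s, g n (fun i => ⌊t n s i⌋)) =ᶠ[atTop]
      fun n : ℕ => (√(n : ℝ) ^ Fintype.card ι)⁻¹ * ∑ᶠ c, g n c := by
    filter_upwards [eventually_ge_atTop 1] with n hn
    have hn0 : (0 : ℝ) < n := by exact_mod_cast hn
    refine integral_floor_smul_add ?_ (Real.sqrt_pos.mpr hn0) _
    refine (finite_setOf_latticePoint_mem hB (hK.isBounded.smul₀ (n : ℝ)) (ℓ n)).subset ?_
    intro c hc
    have : (n : ℝ)⁻¹ • p n c ∈ K :=
      Set.mem_of_indicator_ne_zero (s := {c | (n : ℝ)⁻¹ • p n c ∈ K}) hc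
    rw [Set.mem_ofPred_eq, ← hp]
    exact (Set.mem_smul_set_iff_inv_smul_mem₀ hn0.ne' _ _).mpr this
  refine Tendsto.congr' hsum ?_
  have hgauss : ∫ s : ι → ℝ, ψ x₀ * Real.exp (-(1 / 2) * Q (B *ᵥ s)) =
      ψ x₀ * ((2 * Real.pi) ^ ((Fintype.card ι : ℝ) / 2) / |(M * B).det|) := by
    rw [integral_const_mul, ← integral_exp_neg_half_sum_sq_mulVec (M := M * B)
      (by rw [Matrix.det_mul]; exact mul_ne_zero hM hB)]
    simp [hQdef, Matrix.mulVec_mulVec]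
  rw [← hgauss]
  refine tendsto_integral_filter_of_dominated_convergence
    (fun s => A * Real.exp (κ / k ^ 2) * Real.exp (-(κ / (2 * k ^ 2)) * ‖s‖ ^ 2)) ?_ ?_
    ((integrable_exp_neg_mul_norm_sq ι (by positivity)).const_mul _) ?_
  · refine .of_forall fun n => Measurable.aestronglyMeasurable ?_
    exact (measurable_of_countable (g n)).comp ((measurable_floor_pi ι).comp (by fun_prop))
  · filter_upwards [hbound, eventually_ge_atTop 1] with n hn h1
    refine .of_forall fun s => ?_
    have hn1 : (1 : ℝ) ≤ n := by exact_mod_cast h1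
    by_cases hxK : x n s ∈ K
    · have hb := hn _ ⟨fun i => ⌊t n s i⌋, rfl⟩ hxK
      have hgs : g n (fun i => ⌊t n s i⌋) =
        a n (p n fun i => ⌊t n s i⌋) / (β n * Real.exp (n * φ x₀)) :=
          Set.indicator_of_mem (s := {c | (n : ℝ)⁻¹ • p n c ∈ K}) hxK _
      have hw : 0 < β n * Real.exp (n * φ x₀) := mul_pos (hβ n) (Real.exp_pos _)
      rw [hgs, Real.norm_eq_abs, abs_div, abs_of_pos hw, div_le_iff₀ hw]
      refine hb.trans ?_
      rw [mul_right_comm A, mul_right_comm A, mul_assoc A (Real.exp _), ← Real.exp_add,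
        mul_right_comm A _ (β n * _)]
      gcongr
      set f := (√(n : ℝ))⁻¹ • fun i => Int.fract (t n s i) with hf
      have hf1 : ‖f‖ ≤ 1 := (norm_smul_fract_le _ n).trans
        (inv_le_one_of_one_le₀ (Real.one_le_sqrt.mpr hn1))
      have hnorm : (n : ℝ) * ‖x n s - x₀‖ ^ 2 = ‖B *ᵥ (s - f)‖ ^ 2 := by
        rw [← hdisp n h1 s, norm_smul, mul_pow, Real.norm_eq_abs, sq_abs,
          Real.sq_sqrt n.cast_nonneg]
      have hs : ‖s‖ ≤ k * ‖B *ᵥ (s - f)‖ + 1 := by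
        have := norm_le_norm_sub_add s f
        linarith [hk (s - f)]
      have hs2 : ‖s‖ ^ 2 ≤ 2 * (k ^ 2 * ‖B *ᵥ (s - f)‖ ^ 2) + 2 := by
        nlinarith [norm_nonneg s, sq_nonneg (k * ‖B *ᵥ (s - f)‖ - 1)]
      change -κ * (n * ‖x n s - x₀‖ ^ 2) ≤ _
      rw [hnorm]
      have h2 : κ / (2 * k ^ 2) * ‖s‖ ^ 2 ≤
          κ / (2 * k ^ 2) * (2 * (k ^ 2 * ‖B *ᵥ (s - f)‖ ^ 2) + 2) := by gcongr
      have h3 : κ / (2 * k ^ 2) * (2 * (k ^ 2 * ‖B *ᵥ (s - f)‖ ^ 2) + 2) =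
          κ * ‖B *ᵥ (s - f)‖ ^ 2 + κ / k ^ 2 := by
        field_simp
      linarith
    · have hgs : g n (fun i => ⌊t n s i⌋) = 0 :=
        Set.indicator_of_notMem (s := {c | (n : ℝ)⁻¹ • p n c ∈ K}) hxK _
      rw [hgs, norm_zero]
      positivity
  · refine .of_forall fun s => ?_
    have hf : Tendsto (fun n : ℕ => (√(n : ℝ))⁻¹ • fun i => Int.fract (t n s i)) atTop (𝓝 0) :=
      squeeze_zero_norm (fun n => norm_smul_fract_le _ n) tendsto_inv_sqrt_natCast
    have hBc : Continuous fun v => B *ᵥ v := (Matrix.toLin' B).continuous_of_finiteDimensional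
    have hv : Tendsto (fun n : ℕ => √(n : ℝ) • (x n s - x₀)) atTop (𝓝 (B *ᵥ s)) := by
      have h := (hBc.tendsto (s - 0)).comp ((tendsto_const_nhds (x := s)).sub hf)
      rw [sub_zero] at h
      refine h.congr' ?_
      filter_upwards [eventually_ge_atTop 1] with n hn
      exact (hdisp n hn s).symm
    have hxs : Tendsto (fun n => x n s) atTop (𝓝 x₀) := by
      have h := (tendsto_inv_sqrt_natCast.smul hv).add_const x₀
      rw [zero_smul, zero_add] at h
      refine h.congr' ?_
      filter_upwards [eventually_ge_atTop 1] with n hn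
      have : √(n : ℝ) ≠ 0 := (Real.sqrt_pos.mpr (by exact_mod_cast hn)).ne'
      rw [inv_smul_smul₀ this, sub_add_cancel]
    have hexp := (Real.continuous_exp.tendsto _).comp
      (tendsto_natCast_mul_sub_of_isLittleO hQc hQs hT hxs hv)
    have hmain := (hψ.tendsto.comp hxs).mul hexp
    have herr : Tendsto (fun n : ℕ => δ n * Real.exp ((n : ℝ) * (φ (x n s) - φ x₀)))
        atTop (𝓝 0) := by
      simpa using hδ.mul hexp
    refine tendsto_of_tendsto_of_dist hmain (squeeze_zero' (.of_forall fun _ => dist_nonneg) ?_ herr)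
    filter_upwards [hxs hK₁nhds, eventually_ge_atTop 1] with n hxK hn
    have hxK : x n s ∈ K₁ := hxK
    have hgs : g n (fun i => ⌊t n s i⌋) =
      a n (p n fun i => ⌊t n s i⌋) / (β n * Real.exp (n * φ x₀)) :=
        Set.indicator_of_mem (s := {c | (n : ℝ)⁻¹ • p n c ∈ K}) (hK₁ hxK) _
    have hw : 0 < β n * Real.exp (n * φ x₀) := mul_pos (hβ n) (Real.exp_pos _)
    have he : Real.exp ((n : ℝ) * (φ (x n s) - φ x₀)) =
        Real.exp (n * φ (x n s)) / Real.exp (n * φ x₀) := by rw [mul_sub, Real.exp_sub]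
    have hl := hloc n hn _ hxK
    rw [dist_comm, Real.dist_eq, hgs]
    simp only [Function.comp_apply]
    have hβn := (hβ n).ne'
    rw [he, show a n (p n fun i => ⌊t n s i⌋) / (β n * Real.exp (n * φ x₀)) -
      ψ (x n s) * (Real.exp (n * φ (x n s)) / Real.exp (n * φ x₀)) =
      (a n (p n fun i => ⌊t n s i⌋) - β n * ψ (x n s) * Real.exp (n * φ (x n s))) /
        (β n * Real.exp (n * φ x₀)) by field_simp, abs_div, abs_of_pos hw, div_le_iff₀ hw]
    refine hl.trans (le_of_eq ?_)
    change β n * δ n * Real.exp (n * φ (x n s)) = _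
    field_simp

/-- Laplace summation over a full-rank lattice: Let `L ⊂ ℝ^r` be a
full-rank lattice (given by a ℤ-basis `b` of `r` linearly independent vectors), `K ⊂ ℝ^r`
compact convex with non-empty interior, `φ : K → ℝ` continuous with a unique maximum at
an interior point `x₀`, twice continuously differentiable near `x₀` with strictly
negative definite Hessian `H` there, and `ψ` continuous and positive at `x₀` on a
neighbourhood `K₁ ⊆ K` of `x₀`.  If for each `n` there are `ℓ_n ∈ ℝ^r`, `b_n > 0` and
`a_n` on `(L + ℓ_n) ∩ nK` with `a_n(ℓ) = O(b_n e^{nφ(ℓ/n)+o(n)})` uniformly on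
`(L + ℓ_n) ∩ nK` and `a_n(ℓ) = b_n(ψ(ℓ/n)+o(1))e^{nφ(ℓ/n)}` uniformly on
`(L + ℓ_n) ∩ nK₁`, then
`∑_{ℓ ∈ (L+ℓ_n) ∩ nK} a_n(ℓ) ∼ (2π)^{r/2} ψ(x₀) b_n n^{r/2} e^{nφ(x₀)} /
(Vol(L)·det(−H)^{1/2})` as `n → ∞`. -/
theorem stmt_1 (r : ℕ)
    (b : Fin r → (Fin r → ℝ)) (hb : LinearIndependent ℝ b)
    (L : Set (Fin r → ℝ))
    (hLdef : L = {x | ∃ c : Fin r → ℤ, x = ∑ i, (c i : ℝ) • b i})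
    (K K₁ : Set (Fin r → ℝ))
    (hKcpt : IsCompact K) (hKconv : Convex ℝ K) (hKint : (interior K).Nonempty)
    (φ ψ : (Fin r → ℝ) → ℝ) (hφcont : ContinuousOn φ K)
    (x₀ : Fin r → ℝ) (hx₀ : x₀ ∈ interior K)
    (hmax : ∀ x ∈ K, x ≠ x₀ → φ x < φ x₀)
    (hsmooth : ∃ U : Set (Fin r → ℝ), IsOpen U ∧ x₀ ∈ U ∧ ContDiffOn ℝ 2 φ U)
    (H : Matrix (Fin r) (Fin r) ℝ)
    (hH : ∀ y z : Fin r → ℝ,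
      (fderiv ℝ (fderiv ℝ φ) x₀ y) z = ∑ i, ∑ j, H i j * y i * z j)
    (hHneg : (-H).PosDef)
    (hK₁ : K₁ ⊆ K) (hK₁nhds : K₁ ∈ nhds x₀)
    (hψcont : ContinuousOn ψ K₁) (hψpos : 0 < ψ x₀)
    (ℓn : ℕ → (Fin r → ℝ)) (bn : ℕ → ℝ) (hbn : ∀ n, 0 < bn n)
    (an : ℕ → (Fin r → ℝ) → ℝ)
    (hbig : ∃ C : ℝ, ∃ ε : ℕ → ℝ, Filter.Tendsto ε Filter.atTop (nhds 0) ∧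
      ∀ n : ℕ, 1 ≤ n → ∀ ℓ : Fin r → ℝ, ℓ - ℓn n ∈ L → (n : ℝ)⁻¹ • ℓ ∈ K →
        |an n ℓ| ≤ C * bn n * Real.exp (n * φ ((n : ℝ)⁻¹ • ℓ) + n * ε n))
    (hloc : ∃ δ : ℕ → ℝ, Filter.Tendsto δ Filter.atTop (nhds 0) ∧
      ∀ n : ℕ, 1 ≤ n → ∀ ℓ : Fin r → ℝ, ℓ - ℓn n ∈ L → (n : ℝ)⁻¹ • ℓ ∈ K₁ →
        |an n ℓ - bn n * ψ ((n : ℝ)⁻¹ • ℓ) * Real.exp (n * φ ((n : ℝ)⁻¹ • ℓ))| ≤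
          bn n * δ n * Real.exp (n * φ ((n : ℝ)⁻¹ • ℓ))) :
    Asymptotics.IsEquivalent Filter.atTop
      (fun n : ℕ => ∑ᶠ ℓ ∈ {ℓ : Fin r → ℝ | ℓ - ℓn n ∈ L ∧ (n : ℝ)⁻¹ • ℓ ∈ K}, an n ℓ)
      (fun n : ℕ =>
        (2 * Real.pi) ^ ((r : ℝ) / 2) * ψ x₀ /
          (Real.sqrt (Matrix.det (Matrix.of fun i j => ∑ t, b i t * b j t)) *
            Real.sqrt (Matrix.det (-H))) *
        bn n * (n : ℝ) ^ ((r : ℝ) / 2) * Real.exp (n * φ x₀)) := by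
  obtain ⟨U, hU, hx₀U, hφU⟩ := hsmooth
  obtain ⟨C, ε, hε, hbig⟩ := hbig
  obtain ⟨δ, hδ, hloc⟩ := hloc
  obtain ⟨M, hM, hHM⟩ := hHneg.exists_det_ne_zero_eq_transpose_mul_self
  set B : Matrix (Fin r) (Fin r) ℝ := (Matrix.of b)ᵀ with hBdef
  have hB : B.det ≠ 0 := by
    rw [hBdef, Matrix.det_transpose]
    exact ((Matrix.isUnit_iff_isUnit_det _).mp
      (Matrix.linearIndependent_rows_iff_isUnit.mp hb)).ne_zero
  have hBv : ∀ v : Fin r → ℝ, B *ᵥ v = ∑ i, v i • b i := fun v => by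
    ext j
    simp [hBdef, Matrix.mulVec, dotProduct, mul_comm]
  have hφat : ContDiffAt ℝ 2 φ x₀ := hφU.contDiffAt (hU.mem_nhds hx₀U)
  have hlocmax : IsLocalMax φ x₀ := by
    filter_upwards [mem_interior_iff_mem_nhds.mp hx₀] with x hx
    rcases eq_or_ne x x₀ with rfl | hne
    exacts [le_rfl, (hmax x hx hne).le]
  have hquad : ∀ v, fderiv ℝ (fderiv ℝ φ) x₀ v v = -∑ i, (M *ᵥ v) i ^ 2 := fun v => by
    have h1 : v ⬝ᵥ ((-H) *ᵥ v) = ∑ i, (M *ᵥ v) i ^ 2 := by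
      rw [hHM, ← Matrix.mulVec_mulVec, Matrix.dotProduct_mulVec, Matrix.vecMul_transpose]
      simp [dotProduct, sq]
    rw [hH, ← h1]
    simp only [dotProduct, Matrix.mulVec, Matrix.neg_apply, neg_mul, Finset.sum_neg_distrib,
      mul_neg, neg_neg, Finset.mul_sum]
    exact Finset.sum_congr rfl fun i _ => Finset.sum_congr rfl fun j _ => by ring
  have hT : (fun x => φ x - φ x₀ + 1 / 2 * ∑ i, (M *ᵥ (x - x₀)) i ^ 2)
      =o[𝓝 x₀] fun x => ‖x - x₀‖ ^ 2 := by
    refine hφat.isLittleO_sub_fderiv_sub_snd_fderiv.congr_left fun x => ?_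
    rw [hlocmax.fderiv_eq_zero, hquad]
    simp
  set p : ℕ → (Fin r → ℤ) → Fin r → ℝ := fun n c => ℓn n + B *ᵥ fun i => (c i : ℝ) with hp
  have hpL : ∀ n c, p n c - ℓn n ∈ L := fun n c => by
    rw [hLdef]
    exact ⟨c, by rw [hp]; simp only [add_sub_cancel_left, hBv]⟩
  have hpinj : ∀ n, Function.Injective (p n) := fun n c d hcd => by
    have h := Matrix.mulVec_injective_of_isUnit ((Matrix.isUnit_iff_isUnit_det _).mpr hB.isUnit)
      (add_left_cancel hcd)
    exact funext fun i => by exact_mod_cast congr_fun h i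
  have himage : ∀ n : ℕ, {ℓ : Fin r → ℝ | ℓ - ℓn n ∈ L ∧ (n : ℝ)⁻¹ • ℓ ∈ K} =
      p n '' {c | (n : ℝ)⁻¹ • p n c ∈ K} := fun n => by
    ext ℓ
    constructor
    · rintro ⟨hℓ, hK⟩
      rw [hLdef] at hℓ
      obtain ⟨c, hc⟩ := hℓ
      have hpc : p n c = ℓ := by rw [hp]; simp only [hBv, ← hc, add_sub_cancel]
      exact ⟨c, by rwa [Set.mem_ofPred_eq, hpc], hpc⟩
    · rintro ⟨c, hc, rfl⟩
      exact ⟨hpL n c, hc⟩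
  have hreindex : ∀ n : ℕ,
      ∑ᶠ ℓ ∈ {ℓ : Fin r → ℝ | ℓ - ℓn n ∈ L ∧ (n : ℝ)⁻¹ • ℓ ∈ K}, an n ℓ =
        ∑ᶠ c ∈ {c | (n : ℝ)⁻¹ • p n c ∈ K}, an n (p n c) := fun n => by
    rw [himage, finsum_mem_image (hpinj n).injOn]
  have hlim := tendsto_latticeSum hM hB hKcpt hφcont hmax hT hK₁ hK₁nhds
    (hψcont.continuousAt hK₁nhds) hbn hε hδ (p := p) (fun _ _ => rfl)
    (fun n hn c => hbig n hn _ (hpL n c)) (fun n hn c => hloc n hn _ (hpL n c))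
  have hgram : √(Matrix.det (Matrix.of fun i j => ∑ t, b i t * b j t)) = |B.det| := by
    have : (Matrix.of fun i j => ∑ t, b i t * b j t) = Bᵀ * B := by
      ext i j
      simp [hBdef, Matrix.mul_apply]
    rw [this, Matrix.det_mul, Matrix.det_transpose, Real.sqrt_mul_self_eq_abs]
  have hhess : √(Matrix.det (-H)) = |M.det| := by
    rw [hHM, Matrix.det_mul, Matrix.det_transpose, Real.sqrt_mul_self_eq_abs]
  have hconst : ψ x₀ * ((2 * Real.pi) ^ ((Fintype.card (Fin r) : ℝ) / 2) / |(M * B).det|) =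
      (2 * Real.pi) ^ ((r : ℝ) / 2) * ψ x₀ /
        (√(Matrix.det (Matrix.of fun i j => ∑ t, b i t * b j t)) * √(Matrix.det (-H))) := by
    rw [hgram, hhess, Matrix.det_mul, abs_mul, Fintype.card_fin]
    ring
  rw [hconst] at hlim
  have hne : (2 * Real.pi) ^ ((r : ℝ) / 2) * ψ x₀ /
      (√(Matrix.det (Matrix.of fun i j => ∑ t, b i t * b j t)) * √(Matrix.det (-H))) ≠ 0 := by
    rw [hgram, hhess]
    have := abs_pos.mpr hB
    have := abs_pos.mpr hM
    positivity
  have hequiv := ((Asymptotics.isEquivalent_const_iff_tendsto hne).mpr hlim).mul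
    (Asymptotics.IsEquivalent.refl (u := fun n : ℕ =>
      bn n * (n : ℝ) ^ ((r : ℝ) / 2) * Real.exp (n * φ x₀)))
  refine (hequiv.congr_left ?_).congr_right (.of_forall fun n => ?_)
  · filter_upwards [eventually_ge_atTop 1] with n hn
    have hn0 : (0 : ℝ) < n := by exact_mod_cast hn
    have hpow : √(n : ℝ) ^ Fintype.card (Fin r) = (n : ℝ) ^ ((r : ℝ) / 2) := by
      rw [Real.sqrt_eq_rpow, ← Real.rpow_mul_natCast hn0.le, Fintype.card_fin]
      congr 1
      ring
    have hbn0 := (hbn n).ne'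
    have hpow0 : (n : ℝ) ^ ((r : ℝ) / 2) ≠ 0 := (Real.rpow_pos_of_pos hn0 _).ne'
    refine Eq.trans ?_ (hreindex n).symm
    rw [Pi.mul_apply, ← finsum_mem_def, hpow]
    simp_rw [div_eq_mul_inv]
    rw [← finsum_mem_mul]
    field_simp
  · simp only [Pi.mul_apply, Function.const_apply]
    ring
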